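/- Let X and Y be finite-dimensional with dim Y < dim X, let T be a compact metric space, let x̄ ∈ Ω, and assume the function t ↦ g_t(x̄) is upper semicontinuous on T and the mapping t ↦ ∇g_t(x̄) is continuous on T. Suppose the PMFCQ holds at x̄. If the family {g_t}_{t∈T} is uniformly Fréchet differentiable at x̄, then N̂(x̄; Ω) = cone{∇g_t(x̄) : t ∈ T(x̄)} + ∇h(x̄)*(Y*); if {g_t}_{t∈T} is uniformly strictly differentiable at x̄, then N(x̄; Ω) = cone{∇g_t(x̄) : t ∈ T(x̄)} + ∇h(x̄)*(Y*). -/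

import Mathlib

open Filter Topology Set Pointwise

section Defs

variable {X : Type*} [NormedAddCommGroup X] [NormedSpace ℝ X]

/-- The canonical identification of the dual of `X` with its weak* dual. -/
def toWD (p : X →L[ℝ] ℝ) : WeakDual ℝ X := p

/-- The weak* closure of a subset of the dual. -/
def wkClosure (S : Set (X →L[ℝ] ℝ)) : Set (X →L[ℝ] ℝ) :=
  {p | toWD p ∈ closure (toWD '' S)}

/-- A subset of the dual is weak* closed. -/
def IsWeakStarClosed (S : Set (X →L[ℝ] ℝ)) : Prop :=
  IsClosed (toWD '' S)

/-- A subset of `X* × ℝ` is weak* closed. -/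
def IsWeakStarClosedProd (S : Set ((X →L[ℝ] ℝ) × ℝ)) : Prop :=
  IsClosed ((fun p : (X →L[ℝ] ℝ) × ℝ => (toWD p.1, p.2)) '' S)

/-- The convex conic hull of `S ∪ {0}`: all finite nonnegative combinations of elements of `S`. -/
def coneHull {E : Type*} [AddCommMonoid E] [Module ℝ E] (S : Set E) : Set E :=
  {x | ∃ (n : ℕ) (c : Fin n → ℝ) (v : Fin n → E),
    (∀ i, 0 ≤ c i) ∧ (∀ i, v i ∈ S) ∧ x = ∑ i, c i • v i}

/-- The set of ε-normals to `Ω` at `x`. -/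
def epsNormal (Ω : Set X) (x : X) (ε : ℝ) : Set (X →L[ℝ] ℝ) :=
  {p | ∀ γ > (0:ℝ), ∃ δ > (0:ℝ), ∀ u ∈ Ω, ‖u - x‖ < δ → p (u - x) ≤ (ε + γ) * ‖u - x‖}

/-- The Fréchet (regular) normal cone to `Ω` at `x`. -/
def frechetNormal (Ω : Set X) (x : X) : Set (X →L[ℝ] ℝ) := epsNormal Ω x 0

/-- The limiting (Mordukhovich) normal cone to `Ω` at `xb`. -/
def limitingNormal (Ω : Set X) (xb : X) : Set (X →L[ℝ] ℝ) :=
  {p | ∃ (ε : ℕ → ℝ) (xs : ℕ → X) (ps : ℕ → X →L[ℝ] ℝ),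
    (∀ n, 0 ≤ ε n) ∧ Tendsto ε atTop (𝓝 0) ∧
    (∀ n, xs n ∈ Ω) ∧ Tendsto xs atTop (𝓝 xb) ∧
    (∀ n, ps n ∈ epsNormal Ω (xs n) (ε n)) ∧
    (∀ v : X, Tendsto (fun n => ps n v) atTop (𝓝 (p v)))}

/-- The normal cone of convex analysis to `Ω` at `xb`. -/
def convexNormal (Ω : Set X) (xb : X) : Set (X →L[ℝ] ℝ) :=
  {p | ∀ x ∈ Ω, p (x - xb) ≤ 0}

/-- The subdifferential of convex analysis of `f` at `xb`. -/
def convexSubdiff (f : X → ℝ) (xb : X) : Set (X →L[ℝ] ℝ) :=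
  {p | ∀ x, f xb + p (x - xb) ≤ f x}

variable {Y : Type*} [NormedAddCommGroup Y] [NormedSpace ℝ Y]

/-- The image `A*(Y*)` of the adjoint operator `A* : Y* → X*`. -/
def adjRange (A : X →L[ℝ] Y) : Set (X →L[ℝ] ℝ) :=
  Set.range fun q : Y →L[ℝ] ℝ => q.comp A

variable {T : Type*}

/-- Uniform Fréchet differentiability of the family `g = (g t)` at `xb`:
`s(η) := sup_t sup_{x ∈ B_η(xb), x ≠ xb} |g t x - g t xb - ⟨dg t, x - xb⟩|/‖x - xb‖ → 0` as `η ↓ 0`. -/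
def UnifFrechetDiffAt (g : T → X → ℝ) (dg : T → X →L[ℝ] ℝ) (xb : X) : Prop :=
  ∀ ε > (0:ℝ), ∃ η > (0:ℝ), ∀ t : T, ∀ x : X, ‖x - xb‖ ≤ η →
    |g t x - g t xb - dg t (x - xb)| ≤ ε * ‖x - xb‖

/-- Uniform strict differentiability of the family `g = (g t)` at `xb`:
`r(η) := sup_t sup_{x,x' ∈ B_η(xb), x ≠ x'} |g t x - g t x' - ⟨dg t, x - x'⟩|/‖x - x'‖ → 0`
as `η ↓ 0`. -/
def UnifStrictDiffAt (g : T → X → ℝ) (dg : T → X →L[ℝ] ℝ) (xb : X) : Prop :=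
  ∀ ε > (0:ℝ), ∃ η > (0:ℝ), ∀ t : T, ∀ x x' : X, ‖x - xb‖ ≤ η → ‖x' - xb‖ ≤ η →
    |g t x - g t x' - dg t (x - x')| ≤ ε * ‖x - x'‖

/-- The inequality part of the PMFCQ at `xb` with the direction `xt`:
`inf_{ε>0} sup_{t ∈ T_ε(xb)} ⟨dg t, xt⟩ < 0`, where `T_ε(xb) = {t | g t xb ≥ -ε}`. -/
def PMFCQat (g : T → X → ℝ) (dg : T → X →L[ℝ] ℝ) (xb xt : X) : Prop :=
  ∃ ε > (0:ℝ), ∃ δ > (0:ℝ), ∀ t : T, -ε ≤ g t xb → dg t xt ≤ -δ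

end Defs

section Helpers

theorem aux_coneHull_add {E : Type*} [AddCommMonoid E] [Module ℝ E] {S : Set E} {x y : E}
    (hx : x ∈ coneHull S) (hy : y ∈ coneHull S) : x + y ∈ coneHull S := by
  obtain ⟨n, c, v, hc, hv, rfl⟩ := hx
  obtain ⟨m, d, w, hd, hw, rfl⟩ := hy
  refine ⟨n + m, Fin.append c d, Fin.append v w, ?_, ?_, ?_⟩
  · intro i
    refine Fin.addCases (fun i => ?_) (fun i => ?_) i
    · simpa using hc i
    · simpa using hd i
  · intro i
    refine Fin.addCases (fun i => ?_) (fun i => ?_) i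
    · simpa using hv i
    · simpa using hw i
  · simp [Fin.sum_univ_add]

theorem aux_coneHull_smul {E : Type*} [AddCommMonoid E] [Module ℝ E] {S : Set E} {x : E} {r : ℝ}
    (hr : 0 ≤ r) (hx : x ∈ coneHull S) : r • x ∈ coneHull S := by
  obtain ⟨n, c, v, hc, hv, rfl⟩ := hx
  refine ⟨n, fun i => r * c i, v, fun i => mul_nonneg hr (hc i), hv, ?_⟩
  simp [Finset.smul_sum, mul_smul]

theorem aux_coneHull_zero {E : Type*} [AddCommMonoid E] [Module ℝ E] {S : Set E} :
    (0 : E) ∈ coneHull S :=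
  ⟨0, Fin.elim0, Fin.elim0, fun i => i.elim0, fun i => i.elim0, by simp⟩

theorem aux_coneHull_subset {E : Type*} [AddCommMonoid E] [Module ℝ E] {S : Set E} {x : E}
    (hx : x ∈ S) : x ∈ coneHull S :=
  ⟨1, fun _ => 1, fun _ => x, fun _ => zero_le_one, fun _ => hx, by simp⟩

theorem aux_coneHull_convex {E : Type*} [AddCommGroup E] [Module ℝ E] (S : Set E) :
    Convex ℝ (coneHull S) := by
  intro x hx y hy a b ha hb _
  exact aux_coneHull_add (aux_coneHull_smul ha hx) (aux_coneHull_smul hb hy)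

theorem aux_sum_mem {E : Type*} [AddCommGroup E] [Module ℝ E] (S : Set E) (n : ℕ)
    (c : Fin n → ℝ) (v : Fin n → E) (hc : ∀ i, 0 ≤ c i) (hv : ∀ i, v i ∈ S)
    (N : ℝ) (hN : 0 < N) (hs : ∑ i, c i ≤ N) :
    ∑ i, c i • v i ∈ N • convexHull ℝ (insert 0 S) := by
  have key : ∑ o : Option (Fin n), (o.elim (1 - (∑ i, c i) / N) (fun i => c i / N)) •
      (o.elim (0 : E) v) ∈ convexHull ℝ (insert 0 S) := by
    apply (convex_convexHull ℝ (insert 0 S)).sum_mem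
    · rintro (_ | i) _
      · simp only [Option.elim]
        have : (∑ i, c i) / N ≤ 1 := by rw [div_le_one hN]; exact hs
        linarith
      · exact div_nonneg (hc i) hN.le
    · simp [Fintype.sum_option, Finset.sum_div]
    · rintro (_ | i) _
      · exact subset_convexHull ℝ _ (by simp)
      · exact subset_convexHull ℝ _ (by simp [hv i])
  refine ⟨_, key, ?_⟩
  simp only [Fintype.sum_option, Option.elim, smul_zero, zero_add, Finset.smul_sum, smul_smul]
  refine Finset.sum_congr rfl fun i _ => ?_
  congr 1
  field_simp

theorem aux_compact_hull {E : Type*} [NormedAddCommGroup E] [NormedSpace ℝ E]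
    [FiniteDimensional ℝ E] (S : Set E) (hS : IsCompact S) (h0 : (0 : E) ∈ S) :
    IsCompact (convexHull ℝ S) := by
  let N := Module.finrank ℝ E + 1
  let Φ : (Fin N → ℝ) × (Fin N → E) → E := fun q => ∑ i, q.1 i • q.2 i
  have hΦ : Continuous Φ := by fun_prop
  have hc : IsCompact (stdSimplex ℝ (Fin N) ×ˢ Set.pi univ (fun _ : Fin N => S)) :=
    (isCompact_stdSimplex ℝ (Fin N)).prod (isCompact_univ_pi fun _ => hS)
  suffices hEq : convexHull ℝ S = Φ '' (stdSimplex ℝ (Fin N) ×ˢ Set.pi univ (fun _ => S)) by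
    rw [hEq]; exact hc.image hΦ
  apply Subset.antisymm
  · intro x hx
    obtain ⟨ι, _, z, w, hz, hai, hw, hw1, rfl⟩ := eq_pos_convex_span_of_mem_convexHull hx
    have hcard : Fintype.card ι ≤ Fintype.card (Fin N) := by
      simpa [N] using hai.card_le_finrank_succ.trans
        (Nat.succ_le_succ (Submodule.finrank_le _))
    obtain ⟨e⟩ := Function.Embedding.nonempty_of_card_le hcard
    have he := e.injective
    refine ⟨(Function.extend e w 0, Function.extend e z 0), ⟨⟨?_, ?_⟩, ?_⟩, ?_⟩
    · intro j
      by_cases hj : ∃ i, e i = j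
      · obtain ⟨i, rfl⟩ := hj
        simpa [he.extend_apply] using (hw i).le
      · simp [Function.extend_apply' _ _ _ hj]
    · rw [← hw1]
      symm
      apply Fintype.sum_of_injective e he
      · intro j hj
        simp [Function.extend_apply' _ _ _ hj]
      · intro i
        simp [he.extend_apply]
    · intro j _
      by_cases hj : ∃ i, e i = j
      · obtain ⟨i, rfl⟩ := hj
        simpa [he.extend_apply] using hz ⟨i, rfl⟩
      · simpa [Function.extend_apply' _ _ _ hj] using h0
    · symm
      apply Fintype.sum_of_injective e he
      · intro j hj
        simp [Function.extend_apply' _ _ _ hj]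
      · intro i
        simp [he.extend_apply]
  · rintro _ ⟨⟨w, z⟩, ⟨hw, hz⟩, rfl⟩
    exact (convex_convexHull ℝ S).sum_mem (fun i _ => hw.1 i) hw.2
      (fun i _ => subset_convexHull ℝ S (hz i trivial))

variable {X Y T : Type*} [NormedAddCommGroup X] [NormedSpace ℝ X]
    [FiniteDimensional ℝ X] [NormedAddCommGroup Y] [NormedSpace ℝ Y] [FiniteDimensional ℝ Y]

theorem aux_closed (S : Set (X →L[ℝ] ℝ)) (hS : IsCompact S) (dh : X →L[ℝ] Y) (xt : X)
    (hxt : dh xt = 0) (δ : ℝ) (hδ : 0 < δ) (hSδ : ∀ f ∈ S, f xt ≤ -δ) :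
    IsClosed (coneHull S + adjRange dh) := by
  have hL : IsClosed (adjRange dh) := by
    let A : (Y →L[ℝ] ℝ) →ₗ[ℝ] (X →L[ℝ] ℝ) :=
      { toFun := fun q => q.comp dh
        map_add' := fun _ _ => rfl
        map_smul' := fun _ _ => rfl }
    have : adjRange dh = (LinearMap.range A : Set (X →L[ℝ] ℝ)) := by
      ext f; rfl
    rw [this]
    exact Submodule.closed_of_finiteDimensional _
  refine isClosed_of_closure_subset fun p hp => ?_
  set R := |p xt| + 1 with hR
  have hRpos : 0 < R := by positivity
  have hNpos : 0 < R / δ := by positivity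
  set C := (R / δ) • convexHull ℝ (insert 0 S) with hC
  have hCc : IsCompact C := (aux_compact_hull _ (hS.insert 0) (by simp)).smul _
  have hCL : IsClosed (C + adjRange dh) := hL.add_left_of_isCompact hCc
  have hsub : C ⊆ coneHull S := by
    rintro _ ⟨f, hf, rfl⟩
    refine aux_coneHull_smul hNpos.le ?_
    refine convexHull_min ?_ (aux_coneHull_convex S) hf
    rintro x (rfl | hx)
    · exact aux_coneHull_zero
    · exact aux_coneHull_subset hx
  have hU : IsOpen {f : X →L[ℝ] ℝ | -R < f xt} :=
    isOpen_lt continuous_const (by fun_prop)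
  have hpU : p ∈ {f : X →L[ℝ] ℝ | -R < f xt} := by
    have := neg_abs_le (p xt)
    simp only [mem_ofPred_eq]; linarith
  have hp2 : p ∈ closure ({f : X →L[ℝ] ℝ | -R < f xt} ∩ (coneHull S + adjRange dh)) :=
    hU.inter_closure ⟨hpU, hp⟩
  have hsub2 : {f : X →L[ℝ] ℝ | -R < f xt} ∩ (coneHull S + adjRange dh) ⊆ C + adjRange dh := by
    rintro _ ⟨hf, k, ⟨n, c, v, hc, hv, rfl⟩, _, ⟨q, rfl⟩, rfl⟩
    refine add_mem_add (aux_sum_mem S n c v hc hv _ hNpos ?_) ⟨q, rfl⟩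
    simp [hxt] at hf
    have h1 : ∑ i, c i * v i xt ≤ ∑ i, c i * (-δ) :=
      Finset.sum_le_sum fun i _ => mul_le_mul_of_nonneg_left (hSδ _ (hv i)) (hc i)
    rw [← Finset.sum_mul] at h1
    rw [le_div_iff₀ hδ]
    linarith
  have := closure_minimal hsub2 hCL hp2
  exact add_subset_add_right hsub this

theorem aux_sep (S : Set (X →L[ℝ] ℝ)) (dh : X →L[ℝ] Y)
    (hcl : IsClosed (coneHull S + adjRange dh)) (p : X →L[ℝ] ℝ)
    (hp : p ∉ coneHull S + adjRange dh) :
    ∃ v : X, 0 < p v ∧ dh v = 0 ∧ ∀ f ∈ S, f v ≤ 0 := by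
  have hconvL : Convex ℝ (adjRange dh) := by
    rintro _ ⟨q, rfl⟩ _ ⟨r, rfl⟩ a b _ _ _
    exact ⟨a • q + b • r, by ext; simp⟩
  obtain ⟨F, u, hF, hu⟩ := geometric_hahn_banach_closed_point
    ((aux_coneHull_convex S).add hconvL) hcl hp
  obtain ⟨v, hv⟩ : ∃ v : X, ∀ f : X →L[ℝ] ℝ, F f = f v := by
    let G : Module.Dual ℝ (Module.Dual ℝ X) :=
      F.toLinearMap ∘ₗ (LinearMap.toContinuousLinearMap (𝕜 := ℝ) (E := X) (F' := ℝ)).toLinearMap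
    refine ⟨(Module.evalEquiv ℝ X).symm G, fun f => ?_⟩
    have h1 : (Module.evalEquiv ℝ X) ((Module.evalEquiv ℝ X).symm G) = G := by simp
    have h2 := congrArg (fun H => H f.toLinearMap) h1
    simp only [Module.evalEquiv_apply] at h2
    change f.toLinearMap _ = F _ at h2
    exact h2.symm
  have h0 : (0 : X →L[ℝ] ℝ) ∈ adjRange dh := ⟨0, by simp⟩
  have hu0 : 0 < u := by
    have := hF 0 ⟨0, aux_coneHull_zero, 0, h0, by simp⟩
    simpa using this
  have hS : ∀ f ∈ S, f v ≤ 0 := by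
    intro f hf
    by_contra! hlt
    have := hF _ (add_mem_add (aux_coneHull_smul (r := u / f v) (by positivity)
      (aux_coneHull_subset hf)) h0)
    rw [hv] at this
    simp at this
    rw [div_mul_cancel₀ _ hlt.ne'] at this
    exact lt_irrefl _ this
  refine ⟨v, ?_, ?_, hS⟩
  · rw [← hv]; linarith
  · by_contra hne
    obtain ⟨q, hq⟩ : ∃ q : Y →L[ℝ] ℝ, q (dh v) ≠ 0 := by
      by_contra! hall
      exact hne ((SeparatingDual.eq_zero_iff_forall_dual_eq_zero (R := ℝ) (dh v)).2 hall)
    have := hF _ (add_mem_add (aux_coneHull_zero (S := S))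
      (⟨(u / q (dh v)) • q, rfl⟩ : _ ∈ adjRange dh))
    rw [hv] at this
    simp at this
    rw [div_mul_cancel₀ _ hq] at this
    exact lt_irrefl _ this

/-- Uniform differentiability with base points in `A`. -/
def AuxUnif (A : Set X) (g : T → X → ℝ) (dg : T → X →L[ℝ] ℝ) (xb : X) : Prop :=
  ∀ ε > (0:ℝ), ∃ η > (0:ℝ), ∀ t : T, ∀ x x' : X, x' ∈ A → ‖x - xb‖ ≤ η → ‖x' - xb‖ ≤ η →
    |g t x - g t x' - dg t (x - x')| ≤ ε * ‖x - x'‖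

theorem aux_lyus (h : X → Y) (dh : X →L[ℝ] Y) (xb : X) (hhd : HasStrictFDerivAt h dh xb)
    (hsurj : Function.Surjective dh) (v : X) (hv : dh v = 0) (θ : ℝ) (hθ : 0 < θ) :
    ∃ η > (0:ℝ), ∀ x, h x = 0 → ‖x - xb‖ ≤ η → ∀ s, 0 < s → s ≤ η →
      ∃ w, h w = 0 ∧ ‖w - x - s • v‖ ≤ θ * s := by
  have hr : dh.range = ⊤ := LinearMap.range_eq_top.2 hsurj
  set B := dh.nonlinearRightInverseOfSurjective hr
  have hB : 0 < B.nnnorm := dh.nonlinearRightInverseOfSurjective_nnnorm_pos hr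
  have hκ : (0:ℝ) < (B.nnnorm : ℝ)⁻¹ := by positivity
  set κ := (B.nnnorm : ℝ)⁻¹ with hκd
  -- need c ‖v‖ ≤ (κ - c) θ
  let c : NNReal := ⟨κ * θ / (‖v‖ + θ), by positivity⟩
  have hcpos : 0 < c := by
    change (0:ℝ) < κ * θ / (‖v‖ + θ); positivity
  have hcv : (c : ℝ) * (‖v‖ + θ) = κ * θ := by
    change κ * θ / (‖v‖ + θ) * (‖v‖ + θ) = _
    have : ‖v‖ + θ ≠ 0 := by positivity
    field_simp
  obtain ⟨U, hU, happ⟩ := hhd.approximates_deriv_on_nhds (c := c) (Or.inr hcpos)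
  obtain ⟨ρ, hρ, hball⟩ := Metric.nhds_basis_closedBall.mem_iff.1 hU
  refine ⟨ρ / (1 + ‖v‖ + θ), by positivity, fun x hx hxb s hs hsη => ?_⟩
  set η := ρ / (1 + ‖v‖ + θ) with hη
  have hηρ : η * (1 + ‖v‖ + θ) = ρ := by
    rw [hη]; field_simp
  have hsv : ‖s • v‖ = s * ‖v‖ := by rw [norm_smul, Real.norm_of_nonneg hs.le]
  have hsub : Metric.closedBall (x + s • v) (θ * s) ⊆ U := by
    refine subset_trans ?_ hball
    intro w hw
    rw [Metric.mem_closedBall, dist_eq_norm] at *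
    have : w - xb = (w - (x + s • v)) + (x - xb) + s • v := by abel
    rw [this]
    refine (norm_add₃_le).trans ?_
    rw [hsv]
    nlinarith [norm_nonneg v]
  have hxU : x ∈ U := hball (by
    rw [Metric.mem_closedBall, dist_eq_norm]
    have : 0 ≤ η := by positivity
    nlinarith [norm_nonneg v])
  have huU : x + s • v ∈ U := hsub (Metric.mem_closedBall_self (by positivity))
  have hsur := happ.surjOn_closedBall_of_nonlinearRightInverse B (by positivity) hsub
  have h1 := happ _ huU _ hxU
  simp only [hx, map_smul, hv, add_sub_cancel_left, sub_zero, smul_zero, hsv] at h1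
  obtain ⟨w, hw, hw0⟩ := hsur (show (0:Y) ∈ _ by
    rw [Metric.mem_closedBall, dist_comm, dist_zero_right]
    refine h1.trans ?_
    rw [← hκd]
    nlinarith)
  refine ⟨w, hw0, ?_⟩
  rw [Metric.mem_closedBall, dist_eq_norm] at hw
  rwa [sub_sub]

theorem aux_path (A : Set X) (g : T → X → ℝ) (dg : T → X →L[ℝ] ℝ) (h : X → Y)
    (dh : X →L[ℝ] Y) (xb : X) (hxbA : xb ∈ A)
    (hhd : HasStrictFDerivAt h dh xb) (hbd : ∃ M : ℝ, ∀ t : T, ‖dg t‖ ≤ M)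
    (hsurj : Function.Surjective dh) (hu : AuxUnif A g dg xb)
    (v : X) (hv : dh v = 0) (ε δ : ℝ) (hε : 0 < ε) (hδ : 0 < δ)
    (hvε : ∀ t, -ε ≤ g t xb → dg t v ≤ -δ) (θ : ℝ) (hθ : 0 < θ) :
    ∃ η > (0:ℝ), ∀ x ∈ A, (h x = 0 ∧ ∀ t, g t x ≤ 0) → ‖x - xb‖ ≤ η → ∀ s, 0 < s → s ≤ η →
      ∃ w, (h w = 0 ∧ ∀ t, g t w ≤ 0) ∧ ‖w - x - s • v‖ ≤ θ * s := by
  obtain ⟨M', hM'⟩ := hbd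
  set M := |M'| + 1 with hM
  have hMpos : 0 < M := by positivity
  have hMb : ∀ t, ‖dg t‖ ≤ M := fun t => (hM' t).trans (by linarith [le_abs_self M'])
  set θ' := min θ (min 1 (δ / (2 * M))) with hθ'
  have hθ'pos : 0 < θ' := by positivity
  have hθ'1 : θ' ≤ 1 := (min_le_right _ _).trans (min_le_left _ _)
  have hθ'θ : θ' ≤ θ := min_le_left _ _
  have hθ'M : M * θ' ≤ δ / 2 := by
    have : θ' ≤ δ / (2 * M) := (min_le_right _ _).trans (min_le_right _ _)
    calc M * θ' ≤ M * (δ / (2 * M)) := by gcongr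
      _ = δ / 2 := by field_simp
  set e := min 1 (δ / (2 * (‖v‖ + 1))) with he
  have hepos : 0 < e := by positivity
  have he1 : e ≤ 1 := min_le_left _ _
  have hev : e * (‖v‖ + 1) ≤ δ / 2 := by
    have : e ≤ δ / (2 * (‖v‖ + 1)) := min_le_right _ _
    calc e * (‖v‖ + 1) ≤ δ / (2 * (‖v‖ + 1)) * (‖v‖ + 1) := by gcongr
      _ = δ / 2 := by field_simp
  obtain ⟨η₁, hη₁, hl⟩ := aux_lyus h dh xb hhd hsurj v hv θ' hθ'pos
  obtain ⟨η₂, hη₂, hg⟩ := hu e hepos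
  set D := ‖v‖ + 2 with hD
  have hDpos : 0 < D := by positivity
  set η := min η₁ (min (η₂ / D) (ε / ((M + 1) * D))) with hη
  have hηpos : 0 < η := by positivity
  have hηη₁ : η ≤ η₁ := min_le_left _ _
  have hηη₂ : η * D ≤ η₂ := by
    have : η ≤ η₂ / D := (min_le_right _ _).trans (min_le_left _ _)
    rwa [le_div_iff₀ hDpos] at this
  have hηε : (M + 1) * (η * D) ≤ ε := by
    have : η ≤ ε / ((M + 1) * D) := (min_le_right _ _).trans (min_le_right _ _)
    rw [le_div_iff₀ (by positivity)] at this
    linarith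
  refine ⟨η, hηpos, fun x hxA hx hxη s hs hsη => ?_⟩
  obtain ⟨w, hw0, hw⟩ := hl x hx.1 (hxη.trans hηη₁) s hs (hsη.trans hηη₁)
  have hsv : ‖s • v‖ = s * ‖v‖ := by rw [norm_smul, Real.norm_of_nonneg hs.le]
  have hwx : ‖w - x‖ ≤ s * (‖v‖ + 1) := by
    have : w - x = (w - x - s • v) + s • v := by abel
    rw [this]
    refine (norm_add_le _ _).trans ?_
    rw [hsv]; nlinarith
  have hwxb : ‖w - xb‖ ≤ η * D := by
    have : w - xb = (w - x) + (x - xb) := by abel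
    rw [this]
    refine (norm_add_le _ _).trans ?_
    have : s * (‖v‖ + 1) ≤ η * (‖v‖ + 1) := by gcongr
    rw [hD]; nlinarith
  have hηD : η ≤ η * D := by rw [hD]; nlinarith [norm_nonneg v]
  refine ⟨w, ⟨hw0, fun t => ?_⟩, hw.trans (by gcongr)⟩
  by_cases ht : -ε ≤ g t xb
  · have h1 := (abs_le.1 (hg t w x hxA (hwxb.trans hηη₂) ((hxη.trans hηD).trans hηη₂))).2
    have h2 := hx.2 t
    have h3 : dg t (w - x) = dg t (w - x - s • v) + s * dg t v := by
      rw [map_sub (dg t) (w - x), map_smul, smul_eq_mul]; ring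
    have h4 : dg t (w - x - s • v) ≤ M * (θ' * s) :=
      (le_abs_self _).trans (((dg t).le_opNorm _).trans (by gcongr; exact hMb t))
    have h5 : s * dg t v ≤ s * (-δ) := mul_le_mul_of_nonneg_left (hvε t ht) hs.le
    have h6 : e * ‖w - x‖ ≤ e * (s * (‖v‖ + 1)) := by gcongr
    have h7 : s * (e * (‖v‖ + 1)) ≤ s * (δ / 2) := by gcongr
    have h8 : s * (M * θ') ≤ s * (δ / 2) := by gcongr
    nlinarith
  · push Not at ht
    have h1 := (abs_le.1 (hg t w xb hxbA (hwxb.trans hηη₂) (by simpa using hη₂.le))).2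
    have h4 : dg t (w - xb) ≤ M * (η * D) :=
      (le_abs_self _).trans (((dg t).le_opNorm _).trans (by gcongr; exact hMb t))
    have h6 : e * ‖w - xb‖ ≤ 1 * (η * D) := by gcongr
    linarith

theorem aux_main [MetricSpace T] [CompactSpace T] (A : Set X)
    (g : T → X → ℝ) (dg : T → X →L[ℝ] ℝ) (h : X → Y) (dh : X →L[ℝ] Y) (xb : X) (hxbA : xb ∈ A)
    (hhd : HasStrictFDerivAt h dh xb)
    (hbd : ∃ M : ℝ, ∀ t : T, ‖dg t‖ ≤ M)
    (hxb : xb ∈ {x : X | h x = 0 ∧ ∀ t : T, g t x ≤ 0})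
    (husc : UpperSemicontinuous fun t : T => g t xb)
    (hcont : Continuous fun t : T => dg t)
    (hsurj : Function.Surjective dh)
    (hpmfcq : ∃ xt : X, dh xt = 0 ∧ PMFCQat g dg xb xt)
    (hu : AuxUnif A g dg xb) (p : X →L[ℝ] ℝ) (ε : ℕ → ℝ) (xs : ℕ → X) (ps : ℕ → X →L[ℝ] ℝ)
    (hε : Tendsto ε atTop (𝓝 0)) (hxA : ∀ n, xs n ∈ A)
    (hxs : ∀ n, xs n ∈ {x : X | h x = 0 ∧ ∀ t : T, g t x ≤ 0})
    (hxl : Tendsto xs atTop (𝓝 xb))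
    (hps : ∀ n, ps n ∈ epsNormal {x : X | h x = 0 ∧ ∀ t : T, g t x ≤ 0} (xs n) (ε n))
    (hpl : ∀ v : X, Tendsto (fun n => ps n v) atTop (𝓝 (p v))) :
    p ∈ coneHull (dg '' {t : T | g t xb = 0}) + adjRange dh := by
  by_contra hp
  obtain ⟨xt, hxt, ε₀, hε₀, δ, hδ, hpm⟩ := hpmfcq
  have hact : IsCompact {t : T | g t xb = 0} := by
    have : {t : T | g t xb = 0} = (fun t => g t xb) ⁻¹' Ici 0 := by
      ext t
      exact ⟨fun ht => ht.ge, fun ht => le_antisymm (hxb.2 t) ht⟩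
    rw [this]
    exact (husc.isClosed_preimage 0).isCompact
  have hSδ : ∀ f ∈ dg '' {t : T | g t xb = 0}, f xt ≤ -δ := by
    rintro _ ⟨t, ht, rfl⟩
    exact hpm t (by rw [show g t xb = 0 from ht]; linarith)
  obtain ⟨v₀, hv₀p, hv₀h, hv₀S⟩ := aux_sep _ dh
    (aux_closed _ (hact.image hcont) dh xt hxt δ hδ hSδ) p hp
  obtain ⟨τ, hτ, hτp⟩ : ∃ τ > (0:ℝ), 0 < p (v₀ + τ • xt) := by
    refine ⟨p v₀ / (2 * (|p xt| + 1)), by positivity, ?_⟩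
    rw [map_add, map_smul, smul_eq_mul]
    have h1 : p v₀ / (2 * (|p xt| + 1)) * (|p xt| + 1) = p v₀ / 2 := by field_simp
    have h2 : 0 < p v₀ / (2 * (|p xt| + 1)) := by positivity
    nlinarith [neg_abs_le (p xt)]
  set v := v₀ + τ • xt with hv
  have hvh : dh v = 0 := by simp [hv, hv₀h, hxt]
  have hvact : ∀ t, g t xb = 0 → dg t v ≤ -(τ * δ) := by
    intro t ht
    have h1 := hv₀S _ ⟨t, ht, rfl⟩
    have h2 := hSδ _ ⟨t, ht, rfl⟩
    rw [hv, map_add, map_smul, smul_eq_mul]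
    nlinarith
  have hτδ : 0 < τ * δ := by positivity
  obtain ⟨ε', hε', hvε⟩ : ∃ ε' > (0:ℝ), ∀ t, -ε' ≤ g t xb → dg t v ≤ -(τ * δ / 2) := by
    have hG : IsCompact {t : T | -(τ * δ / 2) ≤ dg t v} :=
      (isClosed_le continuous_const (by fun_prop)).isCompact
    rcases Set.eq_empty_or_nonempty {t : T | -(τ * δ / 2) ≤ dg t v} with hem | hne
    · refine ⟨1, one_pos, fun t _ => ?_⟩
      by_contra! hlt
      have : t ∈ {t : T | -(τ * δ / 2) ≤ dg t v} := hlt.le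
      rw [hem] at this
      exact this
    · obtain ⟨a, haG, hmax⟩ := (husc.upperSemicontinuousOn _).exists_isMaxOn hne hG
      have ha : g a xb < 0 := by
        refine lt_of_le_of_ne (hxb.2 a) fun h0 => ?_
        have h1 := hvact a h0
        have h2 : -(τ * δ / 2) ≤ dg a v := haG
        linarith
      refine ⟨-(g a xb) / 2, by linarith, fun t ht => ?_⟩
      by_contra! hlt
      have : g t xb ≤ g a xb := hmax (show t ∈ {t : T | -(τ * δ / 2) ≤ dg t v} from hlt.le)
      linarith
  obtain ⟨B, hB⟩ : ∃ B, ∀ n, ‖ps n‖ ≤ B := by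
    apply banach_steinhaus
    intro x
    obtain ⟨C, hC⟩ := (hpl x).norm.bddAbove_range
    exact ⟨C, fun n => hC ⟨n, rfl⟩⟩
  have hB0 : 0 ≤ B := (norm_nonneg _).trans (hB 0)
  set a := p v with ha
  set θ := min 1 (a / (8 * (B + 1))) with hθ
  have hθpos : 0 < θ := by positivity
  have hθ1 : θ ≤ 1 := min_le_left _ _
  have hθB : B * θ ≤ a / 8 := by
    have : θ ≤ a / (8 * (B + 1)) := min_le_right _ _
    rw [le_div_iff₀ (by positivity)] at this
    nlinarith
  obtain ⟨η, hη, hpath⟩ := aux_path A g dg h dh xb hxbA hhd hbd hsurj hu v hvh ε' (τ * δ / 2)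
    hε' (by positivity) hvε θ hθpos
  set γ := a / (16 * (‖v‖ + 1)) with hγ
  have hγpos : 0 < γ := by positivity
  have hγv : γ * (‖v‖ + 1) = a / 16 := by rw [hγ]; field_simp
  have e1 : ∀ᶠ n in atTop, ε n < γ := hε.eventually_lt_const hγpos
  have e2 : ∀ᶠ n in atTop, a / 2 < ps n v := (hpl v).eventually_const_lt (by linarith)
  have e3 : ∀ᶠ n in atTop, xs n ∈ Metric.closedBall xb η :=
    hxl (Metric.closedBall_mem_nhds _ hη)
  obtain ⟨n, hn1, hn2, hn3⟩ := (e1.and (e2.and e3)).exists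
  obtain ⟨d, hd, hnorm⟩ := hps n γ hγpos
  rw [Metric.mem_closedBall, dist_eq_norm] at hn3
  set s := min η (d / (2 * (‖v‖ + 1))) with hs
  have hspos : 0 < s := by positivity
  have hsd : s * (‖v‖ + 1) < d := by
    have : s ≤ d / (2 * (‖v‖ + 1)) := min_le_right _ _
    rw [le_div_iff₀ (by positivity)] at this
    linarith
  obtain ⟨w, hw, hws⟩ := hpath (xs n) (hxA n) (hxs n) hn3 s hspos (min_le_left _ _)
  have hsv : ‖s • v‖ = s * ‖v‖ := by rw [norm_smul, Real.norm_of_nonneg hspos.le]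
  have hwx : ‖w - xs n‖ ≤ s * (‖v‖ + 1) := by
    have : w - xs n = (w - xs n - s • v) + s • v := by abel
    rw [this]
    refine (norm_add_le _ _).trans ?_
    rw [hsv]; nlinarith
  have h1 := hnorm w hw (hwx.trans_lt hsd)
  have h3 : ps n (w - xs n) = ps n (w - xs n - s • v) + s * ps n v := by
    rw [map_sub (ps n) (w - xs n), map_smul, smul_eq_mul]; ring
  have h4 : -(B * (θ * s)) ≤ ps n (w - xs n - s • v) :=
    neg_le_of_abs_le (((ps n).le_opNorm _).trans (by gcongr; exact hB n))
  have h5 : (ε n + γ) * ‖w - xs n‖ ≤ (2 * γ) * (s * (‖v‖ + 1)) :=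
    mul_le_mul (by linarith) hwx (norm_nonneg _) (by positivity)
  have h6 : (2 * γ) * (s * (‖v‖ + 1)) = s * (a / 8) := by
    rw [show (2 * γ) * (s * (‖v‖ + 1)) = 2 * s * (γ * (‖v‖ + 1)) by ring, hγv]; ring
  have h7 : s * (a / 2) ≤ s * ps n v := by gcongr
  have h8 : s * (B * θ) ≤ s * (a / 8) := by gcongr
  have h9 : 0 < s * a := by positivity
  nlinarith

theorem aux_easy (g : T → X → ℝ) (dg : T → X →L[ℝ] ℝ) (h : X → Y) (dh : X →L[ℝ] Y) (xb : X)
    (hgd : ∀ t : T, HasFDerivAt (g t) (dg t) xb)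
    (hhd : HasFDerivAt h dh xb)
    (hxb : xb ∈ {x : X | h x = 0 ∧ ∀ t : T, g t x ≤ 0}) :
    coneHull (dg '' {t : T | g t xb = 0}) + adjRange dh ⊆
      frechetNormal {x : X | h x = 0 ∧ ∀ t : T, g t x ≤ 0} xb := by
  rintro _ ⟨_, ⟨n, c, v, hc, hv, rfl⟩, _, ⟨q, rfl⟩, rfl⟩
  choose t ht htv using hv
  have hF : HasFDerivAt (fun x => ∑ i, c i * g (t i) x + q (h x))
      (∑ i, c i • v i + q.comp dh) xb := by
    refine HasFDerivAt.add ?_ (q.hasFDerivAt.comp xb hhd)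
    have := HasFDerivAt.fun_sum (u := Finset.univ) (A := fun i x => c i * g (t i) x)
      (A' := fun i => c i • v i) (x := xb)
      (fun i _ => by
        have := (hgd (t i)).const_mul (c i)
        rwa [htv i] at this)
    exact this
  intro γ hγ
  have h1 := hF.isLittleO.def hγ
  obtain ⟨d, hd, hball⟩ := Metric.eventually_nhds_iff.1 h1
  refine ⟨d, hd, fun u hu hud => ?_⟩
  have h2 := hball (y := u) (by rwa [dist_eq_norm])
  have h3 := neg_le_of_abs_le h2
  have h4 : ∑ i, c i * g (t i) u ≤ 0 :=
    Finset.sum_nonpos fun i _ => mul_nonpos_of_nonneg_of_nonpos (hc i) (hu.2 _)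
  have h5 : ∑ i, c i * g (t i) xb = 0 :=
    Finset.sum_eq_zero fun i _ => by rw [show g (t i) xb = 0 from ht i, mul_zero]
  rw [h5, hu.1, hxb.1] at h3
  simp only [map_zero] at h3
  simp only [zero_add]
  change (∑ i, c i • v i + q.comp dh) (u - xb) ≤ _
  linarith

end Helpers

/-- semi-infinite constraints: let `X, Y` be finite-dimensional with
`dim Y < dim X`, let `T` be a compact metric space, `t ↦ g t xb` upper semicontinuous and
`t ↦ dg t` continuous, and suppose the PMFCQ holds at `xb ∈ Ω`. If `{g t}` is uniformly
Fréchet differentiable at `xb`, then the Fréchet normal cone equals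
`cone{dg t : t ∈ T(xb)} + ∇h(xb)*(Y*)`; if `{g t}` is uniformly strictly differentiable at
`xb`, then the limiting normal cone admits the same representation. -/
theorem statement10 {X Y T : Type*} [NormedAddCommGroup X] [NormedSpace ℝ X]
    [FiniteDimensional ℝ X] [NormedAddCommGroup Y] [NormedSpace ℝ Y] [FiniteDimensional ℝ Y]
    [MetricSpace T] [CompactSpace T]
    (hdim : Module.finrank ℝ Y < Module.finrank ℝ X)
    (g : T → X → ℝ) (dg : T → X →L[ℝ] ℝ) (h : X → Y) (dh : X →L[ℝ] Y) (xb : X)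
    (hgd : ∀ t : T, HasFDerivAt (g t) (dg t) xb)
    (hhd : HasStrictFDerivAt h dh xb)
    (hbd : ∃ M : ℝ, ∀ t : T, ‖dg t‖ ≤ M)
    (hxb : xb ∈ {x : X | h x = 0 ∧ ∀ t : T, g t x ≤ 0})
    (husc : UpperSemicontinuous fun t : T => g t xb)
    (hcont : Continuous fun t : T => dg t)
    (hsurj : Function.Surjective dh)
    (hpmfcq : ∃ xt : X, dh xt = 0 ∧ PMFCQat g dg xb xt) :
    (UnifFrechetDiffAt g dg xb →
        frechetNormal {x : X | h x = 0 ∧ ∀ t : T, g t x ≤ 0} xb =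
          coneHull (dg '' {t : T | g t xb = 0}) + adjRange dh) ∧
      (UnifStrictDiffAt g dg xb →
        limitingNormal {x : X | h x = 0 ∧ ∀ t : T, g t x ≤ 0} xb =
          coneHull (dg '' {t : T | g t xb = 0}) + adjRange dh) := by
  have heasy := aux_easy g dg h dh xb hgd hhd.hasFDerivAt hxb
  constructor
  · intro hu
    refine Subset.antisymm (fun p hp => ?_) heasy
    refine aux_main {xb} g dg h dh xb rfl hhd hbd hxb husc hcont hsurj hpmfcq ?_ p
      (fun _ => 0) (fun _ => xb) (fun _ => p) tendsto_const_nhds (fun _ => rfl) (fun _ => hxb)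
      tendsto_const_nhds (fun _ => hp) (fun _ => tendsto_const_nhds)
    intro e he
    obtain ⟨η, hη, H⟩ := hu e he
    refine ⟨η, hη, ?_⟩
    rintro t x x' rfl hx _
    exact H t x hx
  · intro hu
    refine Subset.antisymm ?_ ?_
    · rintro p ⟨ε, xs, ps, _, hε, hxs, hxl, hps, hpl⟩
      refine aux_main univ g dg h dh xb trivial hhd hbd hxb husc hcont hsurj hpmfcq ?_ p
        ε xs ps hε (fun _ => trivial) hxs hxl hps hpl
      intro e he
      obtain ⟨η, hη, H⟩ := hu e he
      exact ⟨η, hη, fun t x x' _ hx hx' => H t x x' hx hx'⟩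
    · intro p hp
      exact ⟨fun _ => 0, fun _ => xb, fun _ => p, fun _ => le_rfl, tendsto_const_nhds,
        fun _ => hxb, tendsto_const_nhds, fun _ => heasy hp, fun _ => tendsto_const_nhds⟩
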